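/- arXiv:2303.16037 — 7 statements merged into one kernel-verified Lean document; each statement's English description precedes it below -/
import Mathlib

section
/- Let V be a finite-dimensional real vector space and Ω an alternating bilinear form on V. Then for every subspace S ⊆ V one has S^Ω ∩ S^{ΩΩ} = (S ∩ S^Ω) + ker Ω. -/
variable {V : Type*} [AddCommGroup V] [Module ℝ V]

/-- The orthogonal of a subspace `S` with respect to a bilinear form `Ω`:
`S^Ω = {v ∈ V : Ω(v,s) = 0 for all s ∈ S}`. -/
def biOrtho (Ω : V →ₗ[ℝ] V →ₗ[ℝ] ℝ) (S : Submodule ℝ V) : Submodule ℝ V where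
  carrier := {v | ∀ s ∈ S, Ω v s = 0}
  add_mem' := by
    intro a b ha hb s hs
    simp [map_add, LinearMap.add_apply, ha s hs, hb s hs]
  zero_mem' := by intro s hs; simp
  smul_mem' := by
    intro c a ha s hs
    simp [map_smul, LinearMap.smul_apply, ha s hs]

/-- The kernel of a bilinear form `Ω`: `ker Ω = {v ∈ V : Ω(v,w) = 0 for all w ∈ V}`. -/
def kerB (Ω : V →ₗ[ℝ] V →ₗ[ℝ] ℝ) : Submodule ℝ V := biOrtho Ω ⊤

theorem kerB_le_biOrtho (Ω : V →ₗ[ℝ] V →ₗ[ℝ] ℝ) (S : Submodule ℝ V) : kerB Ω ≤ biOrtho Ω S :=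
  fun _ hv s _ => hv s trivial

theorem le_biOrtho_biOrtho (Ω : V →ₗ[ℝ] V →ₗ[ℝ] ℝ) (hΩ : Ω.IsAlt) (S : Submodule ℝ V) :
    S ≤ biOrtho Ω (biOrtho Ω S) :=
  fun s hs _ hw => hΩ.isRefl _ _ (hw s hs)

/-- A functional `Ω v` vanishing on `S^Ω`, the common zeros of the functionals `Ω s`, is itself
of the form `Ω s` with `s ∈ S`. -/
theorem biOrtho_biOrtho_le [FiniteDimensional ℝ V] (Ω : V →ₗ[ℝ] V →ₗ[ℝ] ℝ) (hΩ : Ω.IsAlt)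
    (S : Submodule ℝ V) : biOrtho Ω (biOrtho Ω S) ≤ S ⊔ kerB Ω := by
  intro v hv
  have hmem : Ω v ∈ S.map Ω := by
    rw [← Subspace.dualCoannihilator_dualAnnihilator_eq (W := S.map Ω),
      Submodule.mem_dualAnnihilator]
    intro w hw
    rw [Submodule.mem_dualCoannihilator] at hw
    exact hv w fun s hs => hΩ.isRefl _ _ (hw (Ω s) (Submodule.mem_map_of_mem hs))
  obtain ⟨s, hs, hsv⟩ := hmem
  refine Submodule.mem_sup.2 ⟨s, hs, v - s, fun w _ => ?_, add_sub_cancel s v⟩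
  rw [map_sub, hsv, sub_self, LinearMap.zero_apply]

theorem biOrtho_biOrtho [FiniteDimensional ℝ V] (Ω : V →ₗ[ℝ] V →ₗ[ℝ] ℝ) (hΩ : Ω.IsAlt)
    (S : Submodule ℝ V) : biOrtho Ω (biOrtho Ω S) = S ⊔ kerB Ω :=
  le_antisymm (biOrtho_biOrtho_le Ω hΩ S)
    (sup_le (le_biOrtho_biOrtho Ω hΩ S) (kerB_le_biOrtho Ω _))

/-- For a finite-dimensional real vector space V with alternating
bilinear form Ω, every subspace S satisfies S^Ω ∩ S^ΩΩ = (S ∩ S^Ω) + ker Ω. -/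
theorem orthogonal_inf_double_orthogonal
    [FiniteDimensional ℝ V]
    (Ω : V →ₗ[ℝ] V →ₗ[ℝ] ℝ) (hΩ : ∀ v, Ω v v = 0)
    (S : Submodule ℝ V) :
    biOrtho Ω S ⊓ biOrtho Ω (biOrtho Ω S) = (S ⊓ biOrtho Ω S) ⊔ kerB Ω := by
  rw [biOrtho_biOrtho Ω hΩ S, inf_comm, sup_comm S, sup_inf_assoc_of_le S (kerB_le_biOrtho Ω S),
    sup_comm]
end

section
/- Let V be a finite-dimensional real vector space with alternating bilinear forms ω¹,…,ωᵏ and linear functionals η¹,…,ηᵏ such that (⋂ₐ ker ωᵃ) ∩ (⋂ₐ ker ηᵃ) = {0} and dim(⋂ₐ ker ωᵃ) = k. Then there exist unique vectors R₁,…,R_k ∈ V (the Reeb vectors) such that ωᵇ(Rₐ,w) = 0 for all w ∈ V and ηᵇ(Rₐ) = δᵃᵇ for all a,b = 1,…,k; moreover R₁,…,R_k form a basis of ⋂ₐ ker ωᵃ. -/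
variable {V : Type*} [AddCommGroup V] [Module ℝ V]

/-- The polycosymplectic orthogonal of `S` with respect to a family of bilinear
forms: `S^cω = {v ∈ V : ωᵃ(v,s) = 0 for all s ∈ S and all a}`. -/
def cOrtho {k : ℕ} (ω : Fin k → V →ₗ[ℝ] V →ₗ[ℝ] ℝ) (S : Submodule ℝ V) : Submodule ℝ V :=
  ⨅ a, biOrtho (ω a) S

theorem mem_iInf_kerB {ι : Type*} (ω : ι → V →ₗ[ℝ] V →ₗ[ℝ] ℝ) (v : V) :
    v ∈ (⨅ a, kerB (ω a)) ↔ ∀ a w, ω a v w = 0 := by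
  rw [Submodule.mem_iInf]
  exact forall_congr' fun a => ⟨fun h w => h w trivial, fun h w _ => h w⟩

/-- Functionals `η₁,…,η_k` with no common zero on a `k`-dimensional subspace `K` but `0` are
coordinates on `K`. -/
noncomputable def coordEquiv {ι : Type*} [Fintype ι] (K : Submodule ℝ V) [FiniteDimensional ℝ K]
    (η : ι → V →ₗ[ℝ] ℝ) (h : K ⊓ (⨅ a, LinearMap.ker (η a)) = ⊥)
    (hK : Module.finrank ℝ K = Fintype.card ι) : K ≃ₗ[ℝ] (ι → ℝ) :=
  LinearMap.linearEquivOfInjective ((LinearMap.pi η).domRestrict K)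
    (by
      rw [← LinearMap.ker_eq_bot, LinearMap.ker_domRestrict, LinearMap.ker_pi,
        ← Submodule.disjoint_iff_comap_eq_bot, disjoint_iff]
      exact h)
    (by rw [hK, Module.finrank_fintype_fun_eq_card])

theorem coordEquiv_apply {ι : Type*} [Fintype ι] (K : Submodule ℝ V) [FiniteDimensional ℝ K]
    (η : ι → V →ₗ[ℝ] ℝ) (h : K ⊓ (⨅ a, LinearMap.ker (η a)) = ⊥)
    (hK : Module.finrank ℝ K = Fintype.card ι) (v : K) (a : ι) :
    coordEquiv K η h hK v a = η a v :=
  rfl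

/-- If (⋂ₐ ker ωᵃ) ∩ (⋂ₐ ker ηᵃ) = {0} and dim(⋂ₐ ker ωᵃ) = k, then
there exist unique Reeb vectors R₁,…,R_k with ωᵇ(Rₐ,·) = 0 and ηᵇ(Rₐ) = δᵃᵇ;
moreover any such family is a basis of ⋂ₐ ker ωᵃ. -/
theorem reeb_vectors_exist_unique
    {k : ℕ} [FiniteDimensional ℝ V]
    (ω : Fin k → V →ₗ[ℝ] V →ₗ[ℝ] ℝ) (hωalt : ∀ a v, ω a v v = 0)
    (η : Fin k → V →ₗ[ℝ] ℝ)
    (h2 : (⨅ a, kerB (ω a)) ⊓ (⨅ a, LinearMap.ker (η a)) = ⊥)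
    (h3 : Module.finrank ℝ ↥(⨅ a, kerB (ω a)) = k) :
    (∃! R : Fin k → V,
        (∀ a b, ∀ w, ω b (R a) w = 0) ∧
        (∀ a b, η b (R a) = if a = b then 1 else 0)) ∧
    (∀ R : Fin k → V,
        ((∀ a b, ∀ w, ω b (R a) w = 0) ∧
          (∀ a b, η b (R a) = if a = b then 1 else 0)) →
        LinearIndependent ℝ R ∧
          Submodule.span ℝ (Set.range R) = ⨅ a, kerB (ω a)) := by
  set K := ⨅ a, kerB (ω a)
  let e := coordEquiv K η h2 (by rw [h3, Fintype.card_fin])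
  let B : Module.Basis (Fin k) ℝ K := Module.Basis.ofEquivFun e
  have eB (a b : Fin k) : η b (B a) = if a = b then 1 else 0 := by
    have : e (B a) = Pi.single a 1 := by simp [B]
    rw [← coordEquiv_apply K η h2 (by rw [h3, Fintype.card_fin]) (B a) b]
    exact (congrFun this b).trans (by simp [Pi.single_apply, eq_comm])
  have eq_B (R : Fin k → V) (hR : (∀ a b, ∀ w, ω b (R a) w = 0) ∧
      (∀ a b, η b (R a) = if a = b then 1 else 0)) : R = fun a => (B a : V) := by
    funext a
    have hRK : R a ∈ K := (mem_iInf_kerB ω _).2 (hR.1 a)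
    suffices (⟨R a, hRK⟩ : K) = B a from congrArg Subtype.val this
    apply e.injective
    funext b
    exact (hR.2 a b).trans (eB a b).symm
  refine ⟨⟨fun a => B a, ⟨fun a => (mem_iInf_kerB ω _).1 (B a).2, eB⟩, eq_B⟩, fun R hR => ?_⟩
  rw [eq_B R hR]
  refine ⟨B.linearIndependent.map' K.subtype K.ker_subtype, ?_⟩
  have : (Set.range fun a => (B a : V)) = K.subtype '' Set.range B := by
    rw [← Set.range_comp]; rfl
  rw [this, Submodule.span_image, B.span_eq, Submodule.map_subtype_top]
end

section
/- Let (V, ω¹,…,ωᵏ, η¹,…,ηᵏ) be a k-polycosymplectic vector space with Reeb vectors R₁,…,R_k and 𝓡 = span(R₁,…,R_k) = ⋂ₐ ker ωᵃ, and let S ⊆ V be a subspace with S ⊆ ⋂ₐ ker ηᵃ. Let Q = S^{cω}/(S ∩ S^{cω}) with quotient map π, and let ω_Sᵃ and η_Sᵃ be the (well-defined) alternating bilinear forms and linear functionals on Q determined by ω_Sᵃ(π v, π w) = ωᵃ(v,w) and η_Sᵃ(π v) = ηᵃ(v) for v,w ∈ S^{cω}. Then (Q, ω_Sᵃ, η_Sᵃ)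 is a k-polycosymplectic vector space if and only if S^{cω} ∩ S^{cω cω} = 𝓡 ⊕ (S ∩ S^{cω}) (internal direct sum). -/
variable {V : Type*} [AddCommGroup V] [Module ℝ V]

theorem mem_kerB {Ω : V →ₗ[ℝ] V →ₗ[ℝ] ℝ} {v : V} :
    v ∈ kerB Ω ↔ ∀ w, Ω v w = 0 :=
  ⟨fun h w => h w trivial, fun h w _ => h w⟩

theorem mem_cOrtho {k : ℕ}
    {ω : Fin k → V →ₗ[ℝ] V →ₗ[ℝ] ℝ} {S : Submodule ℝ V} {v : V} :
    v ∈ cOrtho ω S ↔ ∀ a, ∀ s ∈ S, ω a v s = 0 := by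
  simp only [cOrtho, Submodule.mem_iInf]
  rfl

theorem le_cOrtho_cOrtho {k : ℕ}
    {ω : Fin k → V →ₗ[ℝ] V →ₗ[ℝ] ℝ} (hω : ∀ a v, ω a v v = 0) (S : Submodule ℝ V) :
    S ≤ cOrtho ω (cOrtho ω S) := fun s hs => mem_cOrtho.2 fun a t ht => by
  rw [← LinearMap.IsAlt.neg (hω a) t s, mem_cOrtho.1 ht a s hs, neg_zero]

theorem linearIndependent_of_dual_family {k : ℕ}
    {η : Fin k → V →ₗ[ℝ] ℝ} {r : Fin k → V} (h : ∀ a b, η b (r a) = if a = b then 1 else 0) :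
    LinearIndependent ℝ η ∧ LinearIndependent ℝ r := by
  constructor <;> rw [Fintype.linearIndependent_iff] <;> intro g hg a
  · simpa [h] using LinearMap.congr_fun hg (r a)
  · simpa [h] using congrArg (η a) hg

theorem mem_iInf_kerB_mkQ_iff {k : ℕ}
    {ω : Fin k → V →ₗ[ℝ] V →ₗ[ℝ] ℝ} {T : Submodule ℝ V} {N : Submodule ℝ T}
    {ωT : Fin k → (T ⧸ N) →ₗ[ℝ] (T ⧸ N) →ₗ[ℝ] ℝ}
    (hωT : ∀ a (v w : T), ωT a (N.mkQ v) (N.mkQ w) = ω a v w) (v : T) :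
    N.mkQ v ∈ (⨅ a, kerB (ωT a)) ↔ (v : V) ∈ cOrtho ω T := by
  simp only [Submodule.mem_iInf, mem_kerB, mem_cOrtho, N.mkQ_surjective.forall, hωT,
    Subtype.forall]

/-- Let (V, ωᵃ, ηᵃ) be a k-polycosymplectic vector space with Reeb
vectors R₁,…,R_k and 𝓡 = span(R₁,…,R_k) = ⋂ₐ ker ωᵃ, and S ⊆ ⋂ₐ ker ηᵃ a
subspace. Then the quotient Q = S^cω/(S ∩ S^cω), with the descended forms
ω_Sᵃ, η_Sᵃ, is a k-polycosymplectic vector space if and only if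
S^cω ∩ S^cωcω = 𝓡 ⊕ (S ∩ S^cω). -/
theorem polycosymplectic_linear_reduction
    {k : ℕ} [FiniteDimensional ℝ V]
    (ω : Fin k → V →ₗ[ℝ] V →ₗ[ℝ] ℝ) (hωalt : ∀ a v, ω a v v = 0)
    (η : Fin k → V →ₗ[ℝ] ℝ)
    (hηindep : LinearIndependent ℝ η)
    (h2 : (⨅ a, kerB (ω a)) ⊓ (⨅ a, LinearMap.ker (η a)) = ⊥)
    (h3 : Module.finrank ℝ ↥(⨅ a, kerB (ω a)) = k)
    (R : Fin k → V)
    (hR1 : ∀ a b, ∀ w, ω b (R a) w = 0)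
    (hR2 : ∀ a b, η b (R a) = if a = b then 1 else 0)
    (hRspan : Submodule.span ℝ (Set.range R) = ⨅ a, kerB (ω a))
    (S : Submodule ℝ V) (hS : S ≤ ⨅ a, LinearMap.ker (η a))
    (N : Submodule ℝ ↥(cOrtho ω S))
    (hN : N = (S ⊓ cOrtho ω S).comap (cOrtho ω S).subtype)
    (ωS : Fin k → (↥(cOrtho ω S) ⧸ N) →ₗ[ℝ] (↥(cOrtho ω S) ⧸ N) →ₗ[ℝ] ℝ)
    (hωS : ∀ a (v w : ↥(cOrtho ω S)), ωS a (N.mkQ v) (N.mkQ w) = ω a (↑v) (↑w))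
    (ηS : Fin k → (↥(cOrtho ω S) ⧸ N) →ₗ[ℝ] ℝ)
    (hηS : ∀ a (v : ↥(cOrtho ω S)), ηS a (N.mkQ v) = η a (↑v)) :
    (LinearIndependent ℝ ηS ∧
      (⨅ a, kerB (ωS a)) ⊓ (⨅ a, LinearMap.ker (ηS a)) = ⊥ ∧
      Module.finrank ℝ ↥(⨅ a, kerB (ωS a)) = k)
    ↔ (Disjoint (Submodule.span ℝ (Set.range R)) (S ⊓ cOrtho ω S) ∧
        Submodule.span ℝ (Set.range R) ⊔ (S ⊓ cOrtho ω S)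
          = cOrtho ω S ⊓ cOrtho ω (cOrtho ω S)) := by
  have hmemN (v : ↥(cOrtho ω S)) : N.mkQ v = 0 ↔ (v : V) ∈ S := by
    simp [hN, Submodule.Quotient.mk_eq_zero]
  have hmemK := mem_iInf_kerB_mkQ_iff hωS
  have hRT (T : Submodule ℝ V) (a) : R a ∈ cOrtho ω T :=
    mem_cOrtho.2 fun b s _ => hR1 a b s
  have hspanT (T : Submodule ℝ V) : Submodule.span ℝ (Set.range R) ≤ cOrtho ω T :=
    Submodule.span_le.2 (Set.range_subset_iff.2 (hRT T))
  have hηz {x : V} (hx : x ∈ Submodule.span ℝ (Set.range R)) (h : ∀ a, η a x = 0) : x = 0 := by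
    have : x ∈ (⨅ a, kerB (ω a)) ⊓ (⨅ a, LinearMap.ker (η a)) :=
      ⟨hRspan ▸ hx, by simpa [Submodule.mem_iInf] using h⟩
    simpa [h2] using this
  have hηS0 {s : V} (hs : s ∈ S) (a) : η a s = 0 := by
    have := hS hs
    simp only [Submodule.mem_iInf, LinearMap.mem_ker] at this
    exact this a
  set r : Fin k → ↥(cOrtho ω S) ⧸ N := fun a => N.mkQ ⟨R a, hRT S a⟩ with hr
  obtain ⟨hηSindep, hrindep⟩ := linearIndependent_of_dual_family (η := ηS) (r := r)
    fun a b => by rw [hr, hηS, hR2]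
  constructor
  · rintro ⟨-, hQ, -⟩
    refine ⟨Submodule.disjoint_def.2 fun x hx hxS => hηz hx (hηS0 hxS.1), le_antisymm
      (sup_le (le_inf (hspanT _) (hspanT _))
        (le_inf inf_le_right (inf_le_left.trans (le_cOrtho_cOrtho hωalt S)))) ?_⟩
    rintro v ⟨hv, hv'⟩
    have hp : ∑ a, η a v • R a ∈ Submodule.span ℝ (Set.range R) :=
      Submodule.sum_mem _ fun a _ => Submodule.smul_mem _ _ (Submodule.subset_span ⟨a, rfl⟩)
    have hw : v - ∑ a, η a v • R a ∈ cOrtho ω S := sub_mem hv (hspanT _ hp)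
    have hw0 : N.mkQ ⟨_, hw⟩ = 0 := by
      rw [← Submodule.mem_bot ℝ, ← hQ]
      refine ⟨(hmemK _).2 (sub_mem hv' (hspanT _ hp)), ?_⟩
      simp only [SetLike.mem_coe, Submodule.mem_iInf, LinearMap.mem_ker, hηS]
      intro a
      simp [hR2]
    exact Submodule.mem_sup.2 ⟨_, hp, _, ⟨(hmemN _).1 hw0, hw⟩, add_sub_cancel _ _⟩
  · rintro ⟨-, hsum⟩
    refine ⟨hηSindep, (Submodule.eq_bot_iff _).2 ?_, ?_⟩
    · rintro x ⟨hxK, hxη⟩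
      obtain ⟨v, rfl⟩ := N.mkQ_surjective x
      simp only [SetLike.mem_coe, Submodule.mem_iInf, LinearMap.mem_ker, hηS] at hxη
      obtain ⟨p, hp, s, hs, hps⟩ := Submodule.mem_sup.1 (hsum.ge ⟨v.2, (hmemK v).1 hxK⟩)
      have hp0 : p = 0 := hηz hp fun a => by
        have := hxη a
        rwa [← hps, map_add, hηS0 hs.1, add_zero] at this
      rw [hmemN, ← hps, hp0, zero_add]
      exact hs.1
    · have hK : (⨅ a, kerB (ωS a)) = Submodule.span ℝ (Set.range r) := by
        refine le_antisymm (fun x hxK => ?_) (Submodule.span_le.2 (Set.range_subset_iff.2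
          fun a => (hmemK _).2 (hRT _ a)))
        obtain ⟨v, rfl⟩ := N.mkQ_surjective x
        obtain ⟨p, hp, s, hs, hps⟩ := Submodule.mem_sup.1 (hsum.ge ⟨v.2, (hmemK v).1 hxK⟩)
        obtain ⟨c, rfl⟩ := (Submodule.mem_span_range_iff_exists_fun ℝ).1 hp
        have hv : v = ∑ a, c a • (⟨R a, hRT S a⟩ : ↥(cOrtho ω S)) + ⟨s, hs.2⟩ :=
          Subtype.ext (by simp [← hps])
        rw [hv, map_add, (hmemN ⟨s, hs.2⟩).2 hs.1, add_zero, map_sum]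
        simp only [map_smul]
        exact Submodule.sum_mem _ fun a _ =>
          Submodule.smul_mem _ _ (Submodule.subset_span ⟨a, rfl⟩)
      rw [hK, finrank_span_eq_card hrindep, Fintype.card_fin]
end

section
/- Let (V, ω¹,…,ωᵏ, η¹,…,ηᵏ) be a k-polycosymplectic vector space with Reeb vectors R₁,…,R_k, and let S ⊆ V be a subspace with S ⊆ ⋂ₐ ker ηᵃ. Then R₁,…,R_k lie in S^{cω}, and their images π(R₁),…,π(R_k) under the quotient map π : S^{cω} → S^{cω}/(S ∩ S^{cω}) are linearly independent. -/
variable {V : Type*} [AddCommGroup V] [Module ℝ V]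

/-- Let (V, ωᵃ, ηᵃ) be a k-polycosymplectic vector space with Reeb
vectors R₁,…,R_k, and S ⊆ ⋂ₐ ker ηᵃ a subspace. Then R₁,…,R_k lie in S^cω and
their images under the quotient map π : S^cω → S^cω/(S ∩ S^cω) are linearly
independent. -/
theorem reeb_images_linearly_independent
    {k : ℕ} [FiniteDimensional ℝ V]
    (ω : Fin k → V →ₗ[ℝ] V →ₗ[ℝ] ℝ) (hωalt : ∀ a v, ω a v v = 0)
    (η : Fin k → V →ₗ[ℝ] ℝ)
    (hηindep : LinearIndependent ℝ η)
    (h2 : (⨅ a, kerB (ω a)) ⊓ (⨅ a, LinearMap.ker (η a)) = ⊥)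
    (h3 : Module.finrank ℝ ↥(⨅ a, kerB (ω a)) = k)
    (R : Fin k → V)
    (hR1 : ∀ a b, ∀ w, ω b (R a) w = 0)
    (hR2 : ∀ a b, η b (R a) = if a = b then 1 else 0)
    (S : Submodule ℝ V) (hS : S ≤ ⨅ a, LinearMap.ker (η a))
    (N : Submodule ℝ ↥(cOrtho ω S))
    (hN : N = (S ⊓ cOrtho ω S).comap (cOrtho ω S).subtype) :
    ∃ hmem : ∀ a, R a ∈ cOrtho ω S,
      LinearIndependent ℝ (fun a => N.mkQ ⟨R a, hmem a⟩) := by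
  have hmem : ∀ a, R a ∈ cOrtho ω S := fun a =>
    (Submodule.mem_iInf _).2 fun b s _ => hR1 a b s
  refine ⟨hmem, Fintype.linearIndependent_iff.2 fun g hg b => ?_⟩
  have hsum : N.mkQ (∑ a, g a • (⟨R a, hmem a⟩ : cOrtho ω S)) = 0 := by
    simpa only [map_sum, map_smul] using hg
  rw [Submodule.mkQ_apply, Submodule.Quotient.mk_eq_zero, hN] at hsum
  have hker : η b (∑ a, g a • R a) = 0 := by
    simpa using (Submodule.mem_iInf _).1 (hS hsum.1) b
  simpa [hR2] using hker
end

section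
/- On V = ℝ³ × ℝ³ define, for a = 1,2,3, the alternating bilinear forms ωᵃ((b,v),(c,w)) = (v × w)ₐ (the a-th component of the cross product) and the linear functionals ηᵃ((b,v)) = bₐ. Let w₁, w₂ ∈ ℝ³ be linearly independent and let S = {0} × span(w₁,w₂). Then: ⋂ₐ ker ωᵃ = ℝ³ × {0} =: 𝓡; S^{cω} = ℝ³ × {0}; S^{cω cω} = ℝ³ × ℝ³; hence S^{cω cω} ≠ S + 𝓡; but S ∩ S^{cω} = {0} and 𝓡 ⊕ (S ∩ S^{cω}) = S^{cω} ∩ S^{cω cω}. -/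
variable {V : Type*} [AddCommGroup V] [Module ℝ V]

namespace Stmt12

/-- ωᵃ((b,v),(c,w)) = (v × w)ₐ, the a-th component of the cross product. -/
noncomputable def ωc (a : Fin 3) :
    ((Fin 3 → ℝ) × (Fin 3 → ℝ)) →ₗ[ℝ] ((Fin 3 → ℝ) × (Fin 3 → ℝ)) →ₗ[ℝ] ℝ :=
  LinearMap.mk₂ ℝ (fun v w => crossProduct v.2 w.2 a)
    (fun m₁ m₂ n => by
      simp only [Prod.snd_add, map_add, LinearMap.add_apply, Pi.add_apply])
    (fun c m n => by
      simp only [Prod.smul_snd, map_smul, LinearMap.smul_apply, Pi.smul_apply,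
        smul_eq_mul])
    (fun m n₁ n₂ => by
      simp only [Prod.snd_add, map_add, Pi.add_apply])
    (fun c m n => by
      simp only [Prod.smul_snd, map_smul, Pi.smul_apply, smul_eq_mul])

/-- ηᵃ((b,v)) = bₐ. -/
noncomputable def ηc (a : Fin 3) : ((Fin 3 → ℝ) × (Fin 3 → ℝ)) →ₗ[ℝ] ℝ :=
  (LinearMap.proj a).comp (LinearMap.fst ℝ (Fin 3 → ℝ) (Fin 3 → ℝ))

theorem mem_cOrtho {V : Type*} [AddCommGroup V] [Module ℝ V] {k : ℕ}
    {ω : Fin k → V →ₗ[ℝ] V →ₗ[ℝ] ℝ} {S : Submodule ℝ V} {v : V} :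
    v ∈ cOrtho ω S ↔ ∀ a, ∀ s ∈ S, ω a v s = 0 := by
  simp only [cOrtho, Submodule.mem_iInf]
  rfl

theorem mem_cOrtho_ωc {S : Submodule ℝ ((Fin 3 → ℝ) × (Fin 3 → ℝ))}
    {v : (Fin 3 → ℝ) × (Fin 3 → ℝ)} :
    v ∈ cOrtho ωc S ↔ ∀ s ∈ S, crossProduct v.2 s.2 = 0 := by
  rw [mem_cOrtho]
  exact ⟨fun h s hs => funext fun a => h a s hs, fun h a s hs => congrFun (h s hs) a⟩

theorem eq_zero_of_cross_eq_zero {w₁ w₂ v : Fin 3 → ℝ} (hw : LinearIndependent ℝ ![w₁, w₂])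
    (h₁ : crossProduct v w₁ = 0) (h₂ : crossProduct v w₂ = 0) : v = 0 := by
  have hw₁ : w₁ ≠ 0 := hw.ne_zero 0
  have hdep : ¬ LinearIndependent ℝ ![w₁, v] := by
    rw [← crossProduct_ne_zero_iff_linearIndependent, not_not, ← cross_anticomm, h₁, neg_zero]
  rw [LinearIndependent.pair_iff' hw₁] at hdep
  push Not at hdep
  obtain ⟨a, rfl⟩ := hdep
  rw [map_smul, LinearMap.smul_apply, smul_eq_zero] at h₂
  rw [h₂.resolve_right (crossProduct_ne_zero_iff_linearIndependent.2 hw), zero_smul]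

/-- A subspace whose projection to the second factor contains two independent vectors has
orthogonal `ℝ³ × {0}`. -/
theorem cOrtho_ωc_eq_prod {w₁ w₂ : Fin 3 → ℝ} (hw : LinearIndependent ℝ ![w₁, w₂])
    {S : Submodule ℝ ((Fin 3 → ℝ) × (Fin 3 → ℝ))} (h₁ : (0, w₁) ∈ S) (h₂ : (0, w₂) ∈ S) :
    cOrtho ωc S = Submodule.prod ⊤ ⊥ := by
  ext v
  simp only [mem_cOrtho_ωc, Submodule.mem_prod, Submodule.mem_top, true_and, Submodule.mem_bot]
  refine ⟨fun h => eq_zero_of_cross_eq_zero hw (h _ h₁) (h _ h₂), fun h s _ => ?_⟩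
  rw [h, map_zero, LinearMap.zero_apply]

theorem cOrtho_ωc_prod_top_bot : cOrtho ωc (Submodule.prod ⊤ ⊥) = ⊤ := by
  refine eq_top_iff.2 fun v _ => mem_cOrtho_ωc.2 fun s hs => ?_
  rw [(Submodule.mem_bot ℝ).1 (Submodule.mem_prod.1 hs).2, map_zero]

/-- On V = ℝ³ × ℝ³ with ωᵃ given by the cross product and
ηᵃ((b,v)) = bₐ, and S = {0} × span(w₁,w₂) for linearly independent w₁, w₂:
⋂ₐ ker ωᵃ = ℝ³ × {0} = 𝓡, S^cω = ℝ³ × {0}, S^cωcω = ℝ³ × ℝ³, hence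
S^cωcω ≠ S + 𝓡; but S ∩ S^cω = {0} and 𝓡 ⊕ (S ∩ S^cω) = S^cω ∩ S^cωcω. -/
theorem cross_product_example
    (w₁ w₂ : Fin 3 → ℝ) (hw : LinearIndependent ℝ ![w₁, w₂]) :
    (⨅ a, kerB (ωc a)) = Submodule.prod ⊤ ⊥ ∧
    cOrtho ωc (Submodule.prod ⊥ (Submodule.span ℝ {w₁, w₂})) = Submodule.prod ⊤ ⊥ ∧
    cOrtho ωc (cOrtho ωc (Submodule.prod ⊥ (Submodule.span ℝ {w₁, w₂}))) = ⊤ ∧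
    cOrtho ωc (cOrtho ωc (Submodule.prod ⊥ (Submodule.span ℝ {w₁, w₂})))
      ≠ Submodule.prod ⊥ (Submodule.span ℝ {w₁, w₂}) ⊔ Submodule.prod ⊤ ⊥ ∧
    Submodule.prod ⊥ (Submodule.span ℝ {w₁, w₂})
      ⊓ cOrtho ωc (Submodule.prod ⊥ (Submodule.span ℝ {w₁, w₂})) = ⊥ ∧
    Submodule.prod ⊤ ⊥ ⊔
        (Submodule.prod ⊥ (Submodule.span ℝ {w₁, w₂})
          ⊓ cOrtho ωc (Submodule.prod ⊥ (Submodule.span ℝ {w₁, w₂})))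
      = cOrtho ωc (Submodule.prod ⊥ (Submodule.span ℝ {w₁, w₂}))
          ⊓ cOrtho ωc (cOrtho ωc (Submodule.prod ⊥ (Submodule.span ℝ {w₁, w₂}))) := by
  have hS : cOrtho ωc (Submodule.prod ⊥ (Submodule.span ℝ {w₁, w₂})) = Submodule.prod ⊤ ⊥ :=
    cOrtho_ωc_eq_prod hw
      (Submodule.mem_prod.2 ⟨Submodule.zero_mem _, Submodule.subset_span (by simp)⟩)
      (Submodule.mem_prod.2 ⟨Submodule.zero_mem _, Submodule.subset_span (by simp)⟩)
  have hinf : Submodule.prod ⊥ (Submodule.span ℝ {w₁, w₂}) ⊓ Submodule.prod ⊤ ⊥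
      = (⊥ : Submodule ℝ ((Fin 3 → ℝ) × (Fin 3 → ℝ))) := by
    rw [Submodule.prod_inf_prod, bot_inf_eq, inf_bot_eq, Submodule.prod_bot]
  rw [hS, cOrtho_ωc_prod_top_bot, hinf, sup_bot_eq, inf_top_eq]
  refine ⟨cOrtho_ωc_eq_prod hw (S := ⊤) trivial trivial, rfl, rfl, fun h => ?_, rfl, rfl⟩
  rw [Submodule.prod_sup_prod, bot_sup_eq, sup_bot_eq] at h
  have hspan : Submodule.span ℝ {w₁, w₂} = ⊤ := by
    refine eq_top_iff.2 fun v _ => ?_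
    have hv : ((0, v) : (Fin 3 → ℝ) × (Fin 3 → ℝ)) ∈
        Submodule.prod ⊤ (Submodule.span ℝ {w₁, w₂}) := h ▸ Submodule.mem_top
    exact hv.2
  have hcard := finrank_span_le_card (R := ℝ) ({w₁, w₂} : Set (Fin 3 → ℝ))
  rw [hspan, finrank_top, Module.finrank_fin_fun, Set.toFinset_card, ← Nat.card_eq_fintype_card,
    Nat.card_coe_set_eq] at hcard
  have hpair := Set.ncard_insert_le w₁ {w₂}
  rw [Set.ncard_singleton] at hpair
  lia

end Stmt12
end

section
/- Let V be a real vector space, ω an alternating bilinear form on V, and η a linear functional on V, and assume there exists R ∈ V with ω(R,w) = 0 for all w ∈ V and η(R) = 1. Define the alternating bilinear form ω̃ on Ṽ = V × ℝ by ω̃((v,s),(w,t)) = ω(v,w) + s η(w) − t η(v). Then ker ω̃ = (ker ω ∩ ker η) × {0}. -/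
variable {V : Type*} [AddCommGroup V] [Module ℝ V]

/-- If ω is an alternating bilinear form and η a linear functional
on V with a Reeb-type vector R (ω(R,·) = 0, η(R) = 1), then the form
ω̃((v,s),(w,t)) = ω(v,w) + s η(w) − t η(v) on Ṽ = V × ℝ has kernel
ker ω̃ = (ker ω ∩ ker η) × {0}. -/
theorem kernel_of_lifted_form
    (ω : V →ₗ[ℝ] V →ₗ[ℝ] ℝ) (hωalt : ∀ v, ω v v = 0)
    (η : V →ₗ[ℝ] ℝ)
    (R : V) (hR1 : ∀ w, ω R w = 0) (hR2 : η R = 1)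
    (ωt : (V × ℝ) →ₗ[ℝ] (V × ℝ) →ₗ[ℝ] ℝ)
    (hωt : ∀ p q : V × ℝ, ωt p q = ω p.1 q.1 + p.2 * η q.1 - q.2 * η p.1) :
    kerB ωt = (kerB ω ⊓ LinearMap.ker η).prod ⊥ := by
  have hωR : ∀ v, ω v R = 0 := fun v => by
    have h := hωalt (v + R)
    simpa [hωalt, hR1] using h
  ext ⟨v, s⟩
  simp only [Submodule.mem_prod, Submodule.mem_inf, mem_kerB, LinearMap.mem_ker,
    Submodule.mem_bot, hωt]
  constructor
  · intro h
    have hη : η v = 0 := by simpa using h (0, 1)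
    have hs : s = 0 := by simpa [hωR, hR2] using h (R, 0)
    exact ⟨⟨fun w => by simpa [hs] using h (w, 0), hη⟩, hs⟩
  · rintro ⟨⟨hω, hη⟩, rfl⟩ q
    simp [hω, hη]
end

section
/- Let V be a real vector space with alternating bilinear forms ω¹,…,ωᵏ and linear functionals η¹,…,ηᵏ, and let S ⊆ V be a subspace with S ⊆ ⋂ₐ ker ηᵃ. Define ω̃ᵃ on Ṽ = V × ℝ by ω̃ᵃ((v,s),(w,t)) = ωᵃ(v,w) + s ηᵃ(w) − t ηᵃ(v), and let S̃ = S × {0} ⊆ Ṽ. Then the polysymplectic orthogonal of S̃ with respect to the family (ω̃ᵃ) satisfies S̃^{ω̃} = S^{cω} × ℝ. -/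
variable {V : Type*} [AddCommGroup V] [Module ℝ V]

/-- If S ⊆ ⋂ₐ ker ηᵃ and ω̃ᵃ((v,s),(w,t)) = ωᵃ(v,w) + s ηᵃ(w) − t ηᵃ(v)
on Ṽ = V × ℝ, then S̃ = S × {0} satisfies S̃^ω̃ = S^cω × ℝ. -/
theorem lifted_orthogonal
    {k : ℕ}
    (ω : Fin k → V →ₗ[ℝ] V →ₗ[ℝ] ℝ) (hωalt : ∀ a v, ω a v v = 0)
    (η : Fin k → V →ₗ[ℝ] ℝ)
    (S : Submodule ℝ V) (hS : S ≤ ⨅ a, LinearMap.ker (η a))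
    (ωt : Fin k → (V × ℝ) →ₗ[ℝ] (V × ℝ) →ₗ[ℝ] ℝ)
    (hωt : ∀ a (p q : V × ℝ),
      ωt a p q = ω a p.1 q.1 + p.2 * η a q.1 - q.2 * η a p.1) :
    cOrtho ωt (S.prod ⊥) = (cOrtho ω S).prod ⊤ := by
  ext ⟨v, s⟩
  rw [Submodule.mem_prod, mem_cOrtho, mem_cOrtho]
  have hη : ∀ a, ∀ w ∈ S, η a w = 0 := fun a w hw => (Submodule.mem_iInf _).1 (hS hw) a
  constructor
  · intro h
    refine ⟨fun a w hw => ?_, Submodule.mem_top⟩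
    simpa [hωt, hη a w hw] using h a (w, 0) ⟨hw, Submodule.zero_mem _⟩
  · rintro ⟨h, -⟩ a ⟨w, t⟩ ⟨hw, ht⟩
    obtain rfl : t = 0 := ht
    simp [hωt, hη a w hw, h a w hw]
end
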